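/- arXiv:2007.15575 — 4 statements merged into one kernel-verified Lean document; each statement's English description precedes it below -/
import Mathlib

section
/- Let H be a finite group with H = R ⋊ C, i.e., R is a normal subgroup of H and C is a subgroup with R ∩ C = 1 and RC = H, where every element of C squares to the identity (so C is an elementary abelian 2-group). Let σ be a field automorphism of ℂ, let θ be an irreducible complex character of R with θ^σ = θ, and let η be an irreducible complex character of H of odd degree such that θ is an irreducible constituent of the restriction of η to R. Then η^σ = η. -/
/-- `χ : G → ℂ` is an irreducible (ordinary) character of `G`:
it is the character of some simple finite-dimensional complex representation of `G`. -/
def IsIrrChar (G : Type) [Group G] (χ : G → ℂ) : Prop :=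
  ∃ V : FDRep ℂ G, CategoryTheory.Simple V ∧ χ = V.character

open CategoryTheory Representation Module in
theorem aux_irr_of_simple {G : Type} [Group G] (V : FDRep ℂ G) [Simple V] :
    IsIrreducible V.ρ := by
  have hnt : Nontrivial V := by
    by_contra hcon
    have hs : Subsingleton V := not_nontrivial_iff_subsingleton.mp hcon
    apply id_nonzero V
    ext x
    exact Subsingleton.elim (α := V) _ _
  have hbt : (⊥ : Subrepresentation V.ρ) ≠ ⊤ := by
    intro h
    have h2 : (⊥ : Submodule ℂ V) = ⊤ := congrArg Subrepresentation.toSubmodule h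
    exact bot_ne_top h2
  refine { exists_pair_ne := ⟨⊥, ⊤, hbt⟩, eq_bot_or_eq_top := fun W => ?_ }
  let f : FDRep.of W.toRepresentation ⟶ V :=
    ⟨InducedCategory.homMk (ModuleCat.ofHom W.toSubmodule.subtype), fun g => by
      ext x; rfl⟩
  have hmono : Mono f := by
    constructor
    intro Z a b hab
    ext x
    have h3 := congrArg (fun k : Z ⟶ V => k.hom.hom.hom x) hab
    exact congrArg Subtype.val (Subtype.ext h3 : (a.hom.hom.hom x : W.toSubmodule) = b.hom.hom.hom x)
  by_cases hf : f = 0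
  · left
    apply Subrepresentation.toSubmodule_injective
    change W.toSubmodule = ⊥
    rw [Submodule.eq_bot_iff]
    intro x hx
    exact congrArg (fun k : FDRep.of W.toRepresentation ⟶ V => k.hom.hom.hom ⟨x, hx⟩) hf
  · right
    have hiso : IsIso f := isIso_of_mono_of_nonzero hf
    apply Subrepresentation.toSubmodule_injective
    change W.toSubmodule = ⊤
    rw [Submodule.eq_top_iff']
    intro x
    have h4 := congrArg (fun k : V ⟶ V => k.hom.hom.hom x) (IsIso.inv_hom_id f)
    have h5 : (((inv f).hom.hom.hom x : W.toSubmodule) : V) = x := h4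
    rw [← h5]
    exact ((inv f).hom.hom.hom x : W.toSubmodule).2

/-- `W` is stable under all `ρ k`, `k ∈ K`. -/
def AuxStable {H V : Type} [Group H] [AddCommGroup V] [Module ℂ V] (ρ : Representation ℂ H V)
    (K : Subgroup H) (W : Submodule ℂ V) : Prop := ∀ k ∈ K, ∀ v ∈ W, ρ k v ∈ W

theorem aux_stable_sup {H V : Type} [Group H] [AddCommGroup V] [Module ℂ V]
    (ρ : Representation ℂ H V) (K L : Subgroup H) (W : Submodule ℂ V)
    (h1 : AuxStable ρ K W) (h2 : AuxStable ρ L W) : AuxStable ρ (K ⊔ L) W := by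
  let S : Submonoid H :=
    { carrier := {k | ∀ v ∈ W, ρ k v ∈ W}
      one_mem' := by intro v hv; simpa using hv
      mul_mem' := by
        intro a b ha hb v hv
        rw [map_mul]; exact ha _ (hb _ hv) }
  intro k hk
  have : ∀ k ∈ K ⊔ L, k ∈ S := by
    intro k hk
    rw [Subgroup.sup_eq_closure] at hk
    induction hk using Subgroup.closure_induction'' with
    | mem x hx => 
      rcases hx with hx | hx
      · exact h1 x hx
      · exact h2 x hx
    | inv_mem x hx =>
      rcases hx with hx | hx
      · exact h1 _ (inv_mem hx)
      · exact h2 _ (inv_mem hx)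
    | one => exact one_mem S
    | mul x y _ _ hx hy => exact mul_mem hx hy
  exact this k hk

theorem aux_step {H V : Type} [Group H] [AddCommGroup V] [Module ℂ V] [FiniteDimensional ℂ V]
    (ρ : Representation ℂ H V) (hodd : Odd (Module.finrank ℂ V)) (K : Subgroup H)
    (hsq : ∀ h : H, h * h ∈ K) (g : H)
    (hirr : ∀ W, AuxStable ρ (K ⊔ Subgroup.zpowers g) W → W = ⊥ ∨ W = ⊤)
    (W : Submodule ℂ V) (hW : AuxStable ρ K W) : W = ⊥ ∨ W = ⊤ := by
  by_contra! hcon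
  obtain ⟨hb, ht⟩ := hcon
  have hcomp : ∀ a b v, ρ a (ρ b v) = ρ (a * b) v := by
    intro a b v; rw [map_mul]; rfl
  have hconj : ∀ k ∈ K, g⁻¹ * k * g ∈ K := by
    intro k hk
    have e : g⁻¹ * k * g = (g * g)⁻¹ * ((g * k) * (g * k)) * k⁻¹ := by group
    rw [e]
    exact mul_mem (mul_mem (inv_mem (hsq g)) (hsq _)) (inv_mem hk)
  let U : Submodule ℂ V := W.map (ρ g)
  have hUK : AuxStable ρ K U := by
    rintro k hk _ ⟨w, hw, rfl⟩
    refine ⟨ρ (g⁻¹ * k * g) w, hW _ (hconj k hk) w hw, ?_⟩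
    rw [hcomp, hcomp]
    have e : g * (g⁻¹ * k * g) = k * g := by group
    rw [e]
  have hgW : ∀ w ∈ W, ρ g w ∈ U := fun w hw => ⟨w, hw, rfl⟩
  have hgU : ∀ w ∈ U, ρ g w ∈ W := by
    rintro _ ⟨w, hw, rfl⟩
    rw [hcomp]; exact hW _ (hsq g) w hw
  have hz : ∀ X : Submodule ℂ V, AuxStable ρ K X → (∀ x ∈ X, ρ g x ∈ X) →
      AuxStable ρ (K ⊔ Subgroup.zpowers g) X := by
    intro X hXK hX
    apply aux_stable_sup _ _ _ _ hXK
    have hinv : ∀ x ∈ X, ρ g⁻¹ x ∈ X := by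
      intro x hx
      have e : g⁻¹ = (g * g)⁻¹ * g := by group
      rw [e, ← hcomp]
      exact hXK _ (inv_mem (hsq g)) _ (hX x hx)
    have hnat : ∀ n : ℕ, ∀ x ∈ X, ρ (g ^ n) x ∈ X ∧ ρ (g⁻¹ ^ n) x ∈ X := by
      intro n
      induction n with
      | zero => intro x hx; simpa using hx
      | succ n ih =>
        intro x hx
        rw [pow_succ, pow_succ, ← hcomp, ← hcomp]
        exact ⟨(ih _ (hX x hx)).1, (ih _ (hinv x hx)).2⟩
    rintro _ ⟨n, rfl⟩ x hx
    obtain ⟨m, rfl | rfl⟩ := n.eq_nat_or_neg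
    · simpa using (hnat m x hx).1
    · simpa using (hnat m x hx).2
  have hinf : W ⊓ U = ⊥ := by
    rcases hirr (W ⊓ U) (hz _ (fun k hk v hv => ⟨hW k hk v hv.1, hUK k hk v hv.2⟩)
      (fun x hx => ⟨hgU x hx.2, hgW x hx.1⟩)) with h | h
    · exact h
    · exact absurd (eq_top_iff.mpr (h ▸ inf_le_left)) ht
  have hsK : AuxStable ρ K (W ⊔ U) := by
    intro k hk v hv
    obtain ⟨a, ha, b, hb', rfl⟩ := Submodule.mem_sup.mp hv
    rw [map_add]
    exact Submodule.add_mem_sup (hW k hk a ha) (hUK k hk b hb')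
  have hsg : ∀ v ∈ W ⊔ U, ρ g v ∈ W ⊔ U := by
    intro v hv
    obtain ⟨a, ha, b, hb', rfl⟩ := Submodule.mem_sup.mp hv
    rw [map_add, add_comm]
    exact Submodule.add_mem_sup (hgU b hb') (hgW a ha)
  have hsup : W ⊔ U = ⊤ := by
    rcases hirr (W ⊔ U) (hz _ hsK hsg) with h | h
    · exact absurd (eq_bot_iff.mpr (h ▸ le_sup_left)) hb
    · exact h
  have hdim := Submodule.finrank_sup_add_finrank_inf_eq W U
  rw [hinf, hsup, finrank_top, finrank_bot] at hdim
  have hinj : Function.Injective (ρ g) := by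
    intro x y hxy
    have := congrArg (ρ g⁻¹) hxy
    simpa using this
  have hU : Module.finrank ℂ U = Module.finrank ℂ W :=
    (Submodule.equivMapOfInjective (ρ g) hinj W).finrank_eq.symm
  rw [hU] at hdim
  obtain ⟨m, hm⟩ := hodd
  omega

theorem aux_res_irr {H V : Type} [Group H] [Finite H] [AddCommGroup V] [Module ℂ V]
    [FiniteDimensional ℂ V]
    (ρ : Representation ℂ H V) (hodd : Odd (Module.finrank ℂ V)) (R : Subgroup H)
    (hsq : ∀ h : H, h * h ∈ R) (hρ : ρ.IsIrreducible) :
    Representation.IsIrreducible (ρ.comp R.subtype) := by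
  have key : ∀ W, AuxStable ρ R W → W = ⊥ ∨ W = ⊤ := by
    by_contra hcon
    let S : Set (Subgroup H) := {K | R ≤ K ∧ ¬ ∀ W, AuxStable ρ K W → W = ⊥ ∨ W = ⊤}
    have hS : S.Nonempty := ⟨R, le_rfl, hcon⟩
    obtain ⟨K, hK⟩ := (Set.toFinite S).exists_maximal hS
    obtain ⟨⟨hRK, hnot⟩, hmax⟩ := hK
    by_cases hKt : K = ⊤
    · apply hnot
      intro W hW
      rcases hρ.eq_bot_or_eq_top ⟨W, fun g v hv => hW g (hKt ▸ Subgroup.mem_top g) v hv⟩ with h | h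
      · left; exact congrArg Subrepresentation.toSubmodule h
      · right; exact congrArg Subrepresentation.toSubmodule h
    · obtain ⟨g, hg⟩ : ∃ g, g ∉ K := by
        by_contra! h
        exact hKt ((Subgroup.eq_top_iff' K).mpr h)
      apply hnot
      apply aux_step ρ hodd K (fun h => hRK (hsq h)) g
      by_contra hc
      have hmem : K ⊔ Subgroup.zpowers g ∈ S := ⟨hRK.trans le_sup_left, hc⟩
      have := hmax hmem le_sup_left
      exact hg (this (Subgroup.mem_sup_right (Subgroup.mem_zpowers g)))
  have hbt : (⊥ : Submodule ℂ V) ≠ ⊤ := by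
    intro h
    have h2 := hρ.toNontrivial
    obtain ⟨a, b, hab⟩ := h2
    apply hab
    apply Subrepresentation.toSubmodule_injective
    have := subsingleton_of_bot_eq_top h
    exact Subsingleton.elim _ _
  refine { exists_pair_ne := ⟨⊥, ⊤, fun h => hbt (congrArg Subrepresentation.toSubmodule h)⟩,
           eq_bot_or_eq_top := fun W => ?_ }
  rcases key W.toSubmodule (fun k hk v hv => W.apply_mem_toSubmodule ⟨k, hk⟩ hv) with h | h
  · left; exact Subrepresentation.toSubmodule_injective h
  · right; exact Subrepresentation.toSubmodule_injective h

open scoped Matrix ComplexOrder in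
theorem aux_char_inv {G V : Type} [Group G] [Finite G] [AddCommGroup V] [Module ℂ V]
    [FiniteDimensional ℂ V] (ρ : Representation ℂ G V) (g : G) :
    (starRingEnd ℂ) (ρ.character g) = ρ.character g⁻¹ := by
  classical
  have := Fintype.ofFinite G
  let b := Module.finBasis ℂ V
  let M : G → Matrix _ _ ℂ := fun x => LinearMap.toMatrix b b (ρ x)
  have hM1 : M 1 = 1 := by simp [M]
  have hMm : ∀ x y, M (x * y) = M x * M y := by
    intro x y; simp only [M, map_mul]; exact LinearMap.toMatrix_mul b _ _
  have htr : ∀ x, ρ.character x = (M x).trace := fun x =>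
    LinearMap.trace_eq_matrix_trace ℂ b (ρ x)
  let P := ∑ x, (M x)ᴴ * M x
  have hP : P.PosDef := by
    have e : P = 1 + ∑ x ∈ Finset.univ.erase 1, (M x)ᴴ * M x := by
      simp only [P]
      rw [← Finset.add_sum_erase Finset.univ _ (Finset.mem_univ (1 : G)), hM1]
      simp
    rw [e]
    apply Matrix.PosDef.one.add_posSemidef
    exact Matrix.posSemidef_sum _ (fun x _ => Matrix.posSemidef_conjTranspose_mul_self _)
  have hinvt : (M g)ᴴ * P * M g = P := by
    simp only [P, Finset.mul_sum, Finset.sum_mul]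
    rw [← Equiv.sum_comp (Equiv.mulRight g) (fun x => (M x)ᴴ * M x)]
    refine Finset.sum_congr rfl fun x _ => ?_
    simp [hMm, Matrix.conjTranspose_mul, Matrix.mul_assoc]
  have hgg : M g * M g⁻¹ = 1 := by rw [← hMm, mul_inv_cancel, hM1]
  have h1 : (M g)ᴴ * P = P * M g⁻¹ := by
    calc (M g)ᴴ * P = (M g)ᴴ * P * (M g * M g⁻¹) := by rw [hgg, mul_one]
      _ = (M g)ᴴ * P * M g * M g⁻¹ := by simp only [mul_assoc]
      _ = _ := by rw [hinvt]
  have hu : IsUnit P.det := (Matrix.isUnit_iff_isUnit_det P).mp hP.isUnit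
  have h2 : (M g)ᴴ = P * M g⁻¹ * P⁻¹ := by
    rw [← h1, Matrix.mul_assoc, Matrix.mul_nonsing_inv _ hu, mul_one]
  rw [htr, htr]
  have h3 : (M g)ᴴ.trace = (M g⁻¹).trace := by
    rw [h2, Matrix.trace_mul_comm, ← Matrix.mul_assoc, Matrix.nonsing_inv_mul _ hu, one_mul]
  rw [← h3, Matrix.trace_conjTranspose]; rfl

open Representation in
theorem aux_main {H V : Type} [Group H] [Finite H] [AddCommGroup V] [Module ℂ V]
    [FiniteDimensional ℂ V] (ρ : Representation ℂ H V) (hodd : Odd (Module.finrank ℂ V))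
    (R C : Subgroup H) [hR : R.Normal] (hsup : R ⊔ C = ⊤) (hC2 : ∀ c ∈ C, c * c = 1)
    (σ : ℂ ≃+* ℂ) [hirr : IsIrreducible (ρ.comp R.subtype)]
    (hσ : ∀ r ∈ R, σ (ρ.character r) = ρ.character r) (g : H) :
    σ (ρ.character g) = ρ.character g := by
  classical
  have := Fintype.ofFinite R
  let b := Module.finBasis ℂ V
  let n := Module.finrank ℂ V
  let ρ' : Representation ℂ H (Fin n → ℂ) :=
    { toFun := fun h => Matrix.toLin' ((LinearMap.toMatrix b b (ρ h)).map σ)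
      map_one' := by
        simp only [map_one, LinearMap.toMatrix_one]
        rw [Matrix.map_one _ (map_zero σ) (map_one σ), Matrix.toLin'_one]; rfl
      map_mul' := by
        intro x y
        rw [map_mul, LinearMap.toMatrix_mul, Matrix.map_mul, Matrix.toLin'_mul]; rfl }
  have htr : ∀ h, ρ'.character h = σ (ρ.character h) := by
    intro h
    change LinearMap.trace ℂ _ (Matrix.toLin' _) = σ (LinearMap.trace ℂ V (ρ h))
    rw [Matrix.trace_toLin'_eq, LinearMap.trace_eq_matrix_trace ℂ b]
    simp only [Matrix.trace, map_sum]
    rfl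
  have hdet : ∀ h, LinearMap.det (ρ' h) = σ (LinearMap.det (ρ h)) := by
    intro h
    change LinearMap.det (Matrix.toLin' ((LinearMap.toMatrix b b (ρ h)).map σ)) = _
    rw [LinearMap.det_toLin', ← LinearMap.det_toMatrix b]
    exact (RingEquiv.map_det σ _).symm
  have hinv : Invertible (Nat.card R : ℂ) :=
    invertibleOfNonzero (by exact_mod_cast Nat.card_pos.ne')
  have e1 := card_inv_mul_sum_char_mul_char_eq_finrank (ρ.comp R.subtype) (ρ'.comp R.subtype)
  have e2 := card_inv_mul_sum_char_mul_char_eq_finrank (ρ.comp R.subtype) (ρ.comp R.subtype)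
  have hch : ∀ r : R, Representation.character (ρ'.comp R.subtype) r =
      Representation.character (ρ.comp R.subtype) r := by
    intro r
    exact (htr r).trans (hσ r r.2)
  simp only [hch] at e1
  rw [e2, IsIrreducible.finrank_intertwiningMap_self (ρ.comp R.subtype)] at e1
  have hf1 : Module.finrank ℂ
      (IntertwiningMap (ρ.comp R.subtype) (ρ'.comp R.subtype)) = 1 := by
    exact_mod_cast e1.symm
  obtain ⟨f, hf⟩ : ∃ f : IntertwiningMap (ρ.comp R.subtype) (ρ'.comp R.subtype), f ≠ 0 := by
    by_contra! h
    have : Subsingleton (IntertwiningMap (ρ.comp R.subtype) (ρ'.comp R.subtype)) :=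
      ⟨fun x y => by rw [h x, h y]⟩
    rw [Module.finrank_zero_of_subsingleton] at hf1
    exact zero_ne_one hf1
  have hfinj : Function.Injective f.toLinearMap :=
    (IsIrreducible.injective_or_eq_zero f).resolve_right hf
  let T : V ≃ₗ[ℂ] (Fin n → ℂ) := LinearEquiv.ofInjectiveOfFinrankEq f.toLinearMap hfinj
    (by simp [n])
  have hT : ∀ r ∈ R, ∀ v, T (ρ r v) = ρ' r (T v) := by
    intro r hr v
    exact LinearMap.congr_fun (f.isIntertwining' ⟨r, hr⟩) v
  let τ : H →* (V →ₗ[ℂ] V) :=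
    { toFun := fun h => T.symm.conj (ρ' h)
      map_one' := by ext v; simp
      map_mul' := by intro x y; ext v; simp }
  have hτR : ∀ r ∈ R, τ r = ρ r := by
    intro r hr
    ext v
    change T.symm (ρ' r (T v)) = ρ r v
    rw [← hT r hr, T.symm_apply_apply]
  have hτtr : ∀ h, LinearMap.trace ℂ V (τ h) = σ (ρ.character h) := by
    intro h
    rw [← htr]
    exact LinearMap.trace_conj' _ _
  have hτdet : ∀ h, LinearMap.det (τ h) = σ (LinearMap.det (ρ h)) := by
    intro h
    rw [← hdet]
    exact LinearMap.det_conj (ρ' h) T.symm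
  have hsc : ∀ h, ∃ l : ℂ, τ h = l • ρ h := by
    intro h
    let A : IntertwiningMap (ρ.comp R.subtype) (ρ.comp R.subtype) :=
      { toLinearMap := ρ h⁻¹ * τ h
        isIntertwining' := by
          intro r
          change (ρ h⁻¹ * τ h) * ρ r = ρ r * (ρ h⁻¹ * τ h)
          have hc : h * r * h⁻¹ ∈ R := hR.conj_mem r r.2 h
          calc (ρ h⁻¹ * τ h) * ρ r = ρ h⁻¹ * τ (h * r) := by
                rw [← hτR r r.2, map_mul, mul_assoc]
            _ = ρ h⁻¹ * τ ((h * r * h⁻¹) * h) := by congr 2; group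
            _ = ρ h⁻¹ * (ρ (h * r * h⁻¹) * τ h) := by rw [map_mul τ, hτR _ hc]
            _ = ρ (h⁻¹ * (h * r * h⁻¹)) * τ h := by rw [← mul_assoc, ← map_mul]
            _ = ρ (r * h⁻¹) * τ h := by congr 2; group
            _ = _ := by rw [map_mul, mul_assoc] }
    obtain ⟨l, hl⟩ := (IsIrreducible.algebraMap_intertwiningMap_bijective_of_isAlgClosed (ρ := ρ.comp R.subtype)).2 A
    refine ⟨l, ?_⟩
    have hA : ρ h⁻¹ * τ h = l • (1 : V →ₗ[ℂ] V) := by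
      have := congrArg IntertwiningMap.toLinearMap hl
      exact this.symm
    calc τ h = ρ (h * h⁻¹) * τ h := by simp
      _ = ρ h * (ρ h⁻¹ * τ h) := by rw [map_mul, mul_assoc]
      _ = _ := by rw [hA]; simp
  have hnz : Nontrivial V := by
    apply Module.nontrivial_of_finrank_pos (R := ℂ)
    exact hodd.pos
  have hτC : ∀ c ∈ C, τ c = ρ c := by
    intro c hc
    obtain ⟨l, hl⟩ := hsc c
    have hcc : ρ c * ρ c = 1 := by rw [← map_mul, hC2 c hc, map_one]
    have hl2 : l * l = 1 := by
      have h1 : τ c * τ c = 1 := by rw [← map_mul, hC2 c hc, map_one]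
      rw [hl, smul_mul_smul_comm, hcc] at h1
      have h2 : (l * l - 1) • (1 : V →ₗ[ℂ] V) = 0 := by rw [sub_smul, h1, one_smul, sub_self]
      rcases smul_eq_zero.mp h2 with h3 | h3
      · exact sub_eq_zero.mp h3
      · exact absurd h3 one_ne_zero
    have hd2 : LinearMap.det (ρ c) * LinearMap.det (ρ c) = 1 := by
      rw [← map_mul, hcc, map_one]
    have hd0 : LinearMap.det (ρ c) ≠ 0 := by
      intro h; rw [h] at hd2; simp at hd2
    have hds : σ (LinearMap.det (ρ c)) = LinearMap.det (ρ c) := by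
      rcases mul_self_eq_one_iff.mp hd2 with h | h <;> rw [h] <;> simp
    have hld := hτdet c
    rw [hds, hl, LinearMap.det_smul] at hld
    have hln : l ^ Module.finrank ℂ V = 1 := by
      exact mul_right_cancel₀ hd0 (by rw [hld, one_mul])
    obtain ⟨m, hm⟩ := hodd
    have hl1 : l = 1 := by
      rw [hm, pow_succ, pow_mul, pow_two, hl2, one_pow, one_mul] at hln
      exact hln
    rw [hl, hl1, one_smul]
  have hg : g ∈ R ⊔ C := by rw [hsup]; trivial
  obtain ⟨r, hr, c, hc, rfl⟩ := Subgroup.mem_sup_of_normal_left.mp hg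
  rw [← hτtr, map_mul, hτR r hr, hτC c hc, ← map_mul]
  rfl

/-- Let `H = R ⋊ C` be a finite group with `C` an elementary abelian `2`-group,
let `σ` be a field automorphism of `ℂ`, let `θ ∈ Irr(R)` with `θ^σ = θ`, and let
`η ∈ Irr(H)` of odd degree lying over `θ`.  Then `η^σ = η`. -/
theorem stmt_2 {H : Type} [Group H] [Finite H] (R C : Subgroup H) (hR : R.Normal)
    (hinf : R ⊓ C = ⊥) (hsup : R ⊔ C = ⊤) (hC2 : ∀ c ∈ C, c * c = 1)
    (σ : ℂ ≃+* ℂ)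
    (θ : ↥R → ℂ) (hθ : IsIrrChar ↥R θ) (hθσ : (fun x => σ (θ x)) = θ)
    (η : H → ℂ) (hη : IsIrrChar H η) (hηodd : ∃ d : ℕ, Odd d ∧ η 1 = d)
    (hcons : ((Nat.card ↥R : ℂ))⁻¹ * ∑ᶠ x : ↥R, η ↑x * (starRingEnd ℂ) (θ x) ≠ 0) :
    (fun g => σ (η g)) = η := by
  classical
  have := Fintype.ofFinite R
  obtain ⟨W, hW, rfl⟩ := hθ
  obtain ⟨V, hV, rfl⟩ := hη
  have hWi := aux_irr_of_simple W
  have hVi := aux_irr_of_simple V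
  have hodd : Odd (Module.finrank ℂ V) := by
    obtain ⟨d, hd, hd1⟩ := hηodd
    rw [FDRep.char_one] at hd1
    have : Module.finrank ℂ V = d := by exact_mod_cast hd1
    rwa [this]
  have hsq : ∀ h : H, h * h ∈ R := by
    intro h
    have hg : h ∈ R ⊔ C := by rw [hsup]; trivial
    obtain ⟨r, hr, c, hc, rfl⟩ := Subgroup.mem_sup_of_normal_left.mp hg
    have hcc := hC2 c hc
    have hci : c⁻¹ = c := inv_eq_of_mul_eq_one_left hcc
    have h1 := mul_mem hr (hR.conj_mem r hr c)
    rw [hci] at h1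
    convert h1 using 1
    simp only [mul_assoc]
  have hirr := aux_res_irr (H := H) (V := V) V.ρ hodd R hsq hVi
  have hinv : Invertible (Nat.card R : ℂ) :=
    invertibleOfNonzero (by exact_mod_cast Nat.card_pos.ne')
  have horth := Representation.char_orthonormal (V.ρ.comp R.subtype) W.ρ
  have hne : Nonempty (Representation.Equiv W.ρ (V.ρ.comp R.subtype)) := by
    by_contra hno
    rw [if_neg hno] at horth
    apply hcons
    rw [finsum_eq_sum_of_fintype, ← horth]
    congr 1
    refine Finset.sum_congr rfl fun x _ => ?_
    have := aux_char_inv (V := W) W.ρ x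
    rw [← this]
    rfl
  obtain ⟨φ⟩ := hne
  have hchar := Representation.char_iso φ
  funext g
  refine aux_main (H := H) (V := V) V.ρ hodd R C hsup hC2 σ ?_ g
  intro r hr
  have h1 : W.character ⟨r, hr⟩ = Representation.character V.ρ r :=
    congrFun hchar ⟨r, hr⟩
  rw [← h1]
  exact congrFun hθσ ⟨r, hr⟩
end

section
/- Let H be a finite group with H = R ⋊ C, i.e., R is a normal subgroup of H and C is a subgroup of order exactly 2 with R ∩ C = 1 and RC = H. Let Irr_{2',H}(R) denote the set of irreducible complex characters θ of R such that θ is an irreducible constituent of the restriction to R of some odd-degree irreducible complex character of H. Then there exists a map Ξ : Irr_{2',H}(R) → Irr(H) such that for each θ ∈ Irr_{2',H}(R): (i) Ξ(θ) is an irreducible character of H whose restriction to R equals θ (in particular Ξ(θ) has odd degree), and (ii) Ξ(θ^σ) = Ξ(θ)^σ for every field automorphism σ of ℂ (note that Irr_{2',H}(R) is stable under every such σ). -/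
/-- `θ ∈ Irr_{2',H}(R)`: `θ` is an irreducible character of `R` that is a constituent of the
restriction to `R` of some odd-degree irreducible character of `H`. -/
def MemIrrOddH {H : Type} [Group H] (R : Subgroup H) (θ : ↥R → ℂ) : Prop :=
  IsIrrChar ↥R θ ∧
    ∃ η : H → ℂ, IsIrrChar H η ∧ (∃ d : ℕ, Odd d ∧ η 1 = d) ∧
      ((Nat.card ↥R : ℂ))⁻¹ * ∑ᶠ x : ↥R, η ↑x * (starRingEnd ℂ) (θ x) ≠ 0


open scoped Classical in
/-- Two irreducible characters are equal or orthogonal. -/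
theorem IsIrrChar.orth {G : Type} [Group G] [Fintype G] {χ ψ : G → ℂ}
    (hχ : IsIrrChar G χ) (hψ : IsIrrChar G ψ) :
    χ = ψ ∨ ∑ g : G, χ g * ψ g⁻¹ = 0 := by
  obtain ⟨V, hV, rfl⟩ := hχ
  obtain ⟨W, hW, rfl⟩ := hψ
  have : Invertible (Nat.card G : ℂ) := invertibleOfNonzero (NeZero.ne (Nat.card G : ℂ))
  have h := FDRep.char_orthonormal V W
  by_cases hn : Nonempty (V ≅ W)
  · exact Or.inl (FDRep.char_iso hn.some)
  · right
    rw [if_neg hn] at h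
    rcases mul_eq_zero.1 h with h | h
    · exact absurd h (inv_ne_zero (NeZero.ne (Nat.card G : ℂ)))
    · exact h

theorem IsIrrChar.norm {G : Type} [Group G] [Fintype G] {χ : G → ℂ}
    (hχ : IsIrrChar G χ) : ∑ g : G, χ g * χ g⁻¹ = Nat.card G := by
  obtain ⟨V, hV, rfl⟩ := hχ
  exact (FDRep.simple_iff_char_is_norm_one V).1 hV

theorem isIrrChar_of_norm {G : Type} [Group G] [Fintype G] {V : Type} [AddCommGroup V]
    [Module ℂ V] [Module.Finite ℂ V] (ρ : Representation ℂ G V) (χ : G → ℂ)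
    (h : ∀ g, LinearMap.trace ℂ V (ρ g) = χ g)
    (hn : ∑ g : G, χ g * χ g⁻¹ = Nat.card G) : IsIrrChar G χ := by
  have hc : χ = (FDRep.of ρ).character := by
    funext g
    rw [← h g]
    rfl
  refine ⟨FDRep.of ρ, ?_, hc⟩
  rw [FDRep.simple_iff_char_is_norm_one, ← hc]
  exact hn

theorem IsIrrChar.exists_rep {G : Type} [Group G] {χ : G → ℂ}
    (hχ : IsIrrChar G χ) : ∃ (V : Type) (_ : AddCommGroup V) (_ : Module ℂ V)
      (_ : Module.Finite ℂ V) (ρ : Representation ℂ G V),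
      ∀ g, LinearMap.trace ℂ V (ρ g) = χ g := by
  obtain ⟨V, hV, rfl⟩ := hχ
  exact ⟨V, inferInstance, inferInstance, inferInstance, V.ρ, fun g => rfl⟩

theorem IsIrrChar.twist {G : Type} [Group G] [Fintype G] {χ : G → ℂ}
    (hχ : IsIrrChar G χ) (l : G →* ℂ) : IsIrrChar G (fun g => l g * χ g) := by
  obtain ⟨V, _, _, _, ρ, h⟩ := hχ.exists_rep
  refine isIrrChar_of_norm (V := V)
    { toFun := fun g => l g • ρ g
      map_one' := by simp
      map_mul' := fun a b => by
        simp only [map_mul, smul_mul_assoc, mul_smul_comm, smul_smul]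
        rw [mul_comm] } _ ?_ ?_
  · intro g
    simp [h]
  · rw [← hχ.norm]
    refine Finset.sum_congr rfl fun g _ => ?_
    have : l g * l g⁻¹ = 1 := by rw [← map_mul]; simp
    linear_combination (χ g * χ g⁻¹) * this

theorem IsIrrChar.galois {G : Type} [Group G] [Fintype G] {χ : G → ℂ}
    (hχ : IsIrrChar G χ) (σ : ℂ ≃+* ℂ) : IsIrrChar G (fun g => σ (χ g)) := by
  obtain ⟨V, _, _, _, ρ, h⟩ := hχ.exists_rep
  let b := Module.finBasis ℂ V
  let n := Module.finrank ℂ V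
  let M : G →* Matrix (Fin n) (Fin n) ℂ :=
    ((LinearMap.toMatrixAlgEquiv b : _ →* Matrix (Fin n) (Fin n) ℂ)).comp ρ
  let N : Representation ℂ G (Fin n → ℂ) :=
    (Matrix.toLinAlgEquiv' (R := ℂ) (n := Fin n)).toRingEquiv.toRingHom.toMonoidHom.comp
      (((σ : ℂ →+* ℂ).mapMatrix : Matrix (Fin n) (Fin n) ℂ →+* Matrix (Fin n) (Fin n) ℂ).toMonoidHom.comp M)
  refine isIrrChar_of_norm N _ ?_ ?_
  · intro g
    have h1 : N g = Matrix.toLin' ((M g).map σ) := rfl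
    have h2 : M g = LinearMap.toMatrix b b (ρ g) := rfl
    rw [h1, Matrix.trace_toLin'_eq, ← h g, LinearMap.trace_eq_matrix_trace ℂ b, ← h2]
    simp only [Matrix.trace, map_sum]
    rfl
  · have := congrArg σ hχ.norm
    simpa using this

theorem IsIrrChar.res {G : Type} [Group G] {χ : G → ℂ}
    (hχ : IsIrrChar G χ) (R : Subgroup G) [Fintype R]
    (hn : ∑ x : R, χ x * χ (x⁻¹ : R) = Nat.card R) : IsIrrChar R (fun x => χ x) := by
  obtain ⟨V, _, _, _, ρ, h⟩ := hχ.exists_rep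
  exact isIrrChar_of_norm (MonoidHom.comp ρ R.subtype) _ (fun x => h x) hn

theorem IsIrrChar.involution {G : Type} [Group G] {χ : G → ℂ}
    (hχ : IsIrrChar G χ) (c : G) (hc : c * c = 1) : ∃ b : ℕ, χ c = 2 * b - χ 1 := by
  obtain ⟨V, _, _, _, ρ, h⟩ := hχ.exists_rep
  have hcc : ρ c * ρ c = 1 := by rw [← map_mul, hc, map_one]
  let P : V →ₗ[ℂ] V := (2⁻¹ : ℂ) • (1 + ρ c)
  have hP : IsIdempotentElem P := by
    change P * P = P
    simp only [P, smul_mul_smul_comm, mul_add, add_mul, one_mul, mul_one, hcc]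
    module
  have ht := (LinearMap.IsIdempotentElem.isProj_range P hP).trace
  refine ⟨Module.finrank ℂ (LinearMap.range P), ?_⟩
  rw [← ht, ← h, ← h]
  simp only [P, map_smul, map_add, map_one, smul_eq_mul]
  ring

theorem trace_inv_eq_conj {V : Type} [AddCommGroup V] [Module ℂ V] [Module.Finite ℂ V]
    (f g : Module.End ℂ V) (n : ℕ) (hn : n ≠ 0) (hf : f ^ n = 1) (hfg : g * f = 1) :
    LinearMap.trace ℂ V g = (starRingEnd ℂ) (LinearMap.trace ℂ V f) := by
  have hss : f.IsSemisimple := by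
    refine Module.End.isSemisimple_of_squarefree_aeval_eq_zero
      (p := (Polynomial.X ^ n - 1 : Polynomial ℂ)) ?_ ?_
    · exact (Polynomial.X_pow_sub_one_separable_iff.2 (by exact_mod_cast hn)).squarefree
    · simp [hf]
  have htop := hss.iSup_eigenspace_eq_top
  have hind := Module.End.eigenspaces_iSupIndep f
  have hint : DirectSum.IsInternal f.eigenspace :=
    (DirectSum.isInternal_submodule_iff_iSupIndep_and_iSup_eq_top _).2 ⟨hind, htop⟩
  have hfin : {μ | f.eigenspace μ ≠ ⊥}.Finite :=
    WellFoundedGT.finite_ne_bot_of_iSupIndep hind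
  have hgv : ∀ μ, f.eigenspace μ ≠ ⊥ → ‖μ‖ = 1 := by
    intro μ hμ
    obtain ⟨v, hv, hv0⟩ := Submodule.exists_mem_ne_zero_of_ne_bot hμ
    have h1 : (f ^ n) v = μ ^ n • v :=
      Module.End.HasEigenvector.pow_apply ⟨hv, hv0⟩ n
    rw [hf] at h1
    have h2 : (μ ^ n - 1) • v = 0 := by rw [sub_smul, ← h1]; simp
    have h3 : μ ^ n = 1 := by
      rcases smul_eq_zero.1 h2 with h | h
      · exact sub_eq_zero.1 h
      · exact absurd h hv0
    exact Complex.norm_eq_one_of_pow_eq_one h3 hn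
  have hmf : ∀ μ, Set.MapsTo f (f.eigenspace μ) (f.eigenspace μ) := by
    intro μ v hv
    have : f v = μ • v := Module.End.mem_eigenspace_iff.1 hv
    rw [this]
    exact Submodule.smul_mem _ _ hv
  have hgg : ∀ μ, ∀ v ∈ f.eigenspace μ, g v = (starRingEnd ℂ μ) • v := by
    intro μ v hv
    by_cases hb : f.eigenspace μ = ⊥
    · rw [hb, Submodule.mem_bot] at hv
      simp [hv]
    have h1 : f v = μ • v := Module.End.mem_eigenspace_iff.1 hv
    have h2 : g (f v) = v := LinearMap.congr_fun hfg v
    rw [h1, map_smul] at h2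
    have h3 : starRingEnd ℂ μ * μ = 1 := by
      rw [mul_comm, Complex.mul_conj, Complex.normSq_eq_norm_sq, hgv μ hb]; simp
    rw [← one_smul ℂ (g v), ← h3, mul_smul, h2]
  have hmg : ∀ μ, Set.MapsTo g (f.eigenspace μ) (f.eigenspace μ) := by
    intro μ v hv
    rw [hgg μ v hv]
    exact Submodule.smul_mem _ _ hv
  rw [LinearMap.trace_eq_sum_trace_restrict' hint hfin hmg,
    LinearMap.trace_eq_sum_trace_restrict' hint hfin hmf, map_sum]
  refine Finset.sum_congr rfl fun μ _ => ?_
  have e1 : g.restrict (hmg μ) = (starRingEnd ℂ μ) • 1 := by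
    ext v
    exact hgg μ v v.2
  have e2 : f.restrict (hmf μ) = μ • 1 := by
    ext v
    exact Module.End.mem_eigenspace_iff.1 v.2
  rw [e1, e2]
  simp

theorem IsIrrChar.inv {G : Type} [Group G] [Finite G] {χ : G → ℂ}
    (hχ : IsIrrChar G χ) (g : G) : χ g⁻¹ = (starRingEnd ℂ) (χ g) := by
  obtain ⟨V, _, _, _, ρ, h⟩ := hχ.exists_rep
  rw [← h, ← h]
  refine trace_inv_eq_conj _ _ (Nat.card G) Nat.card_pos.ne' ?_ ?_
  · rw [← map_pow, pow_card_eq_one', map_one]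
  · rw [← map_mul, inv_mul_cancel, map_one]

open scoped Classical in
/-- The sign character of an index two subgroup. -/
noncomputable def idxTwoSign {H : Type} [Group H] (R : Subgroup H) (h2 : R.index = 2) : H →* ℂ where
  toFun g := if g ∈ R then 1 else -1
  map_one' := by simp [R.one_mem]
  map_mul' a b := by
    have := Subgroup.mul_mem_iff_of_index_two h2 (a := a) (b := b)
    by_cases ha : a ∈ R <;> by_cases hb : b ∈ R <;> simp [this, ha, hb]

theorem idxTwoSign_mem {H : Type} [Group H] (R : Subgroup H) (h2 : R.index = 2) {g : H}
    (hg : g ∈ R) : idxTwoSign R h2 g = 1 := if_pos hg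

theorem idxTwoSign_not_mem {H : Type} [Group H] (R : Subgroup H) (h2 : R.index = 2) {g : H}
    (hg : g ∉ R) : idxTwoSign R h2 g = -1 := if_neg hg

open scoped Classical in
theorem sum_add_sign {H : Type} [Group H] [Fintype H] (R : Subgroup H) [Fintype R]
    (h2 : R.index = 2) (f : H → ℂ) :
    ∑ g, f g + ∑ g, idxTwoSign R h2 g * f g = 2 * ∑ x : R, f x := by
  have h1 : ∑ x : R, f x = ∑ g ∈ Finset.univ.filter (· ∈ R), f g := by
    symm
    exact Finset.sum_subtype _ (by simp) _
  rw [h1, ← Finset.sum_add_distrib, Finset.sum_filter, Finset.mul_sum]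
  refine Finset.sum_congr rfl fun g _ => ?_
  by_cases hg : g ∈ R
  · rw [idxTwoSign_mem R h2 hg, if_pos hg]; ring
  · rw [idxTwoSign_not_mem R h2 hg, if_neg hg]; ring

/-- An irreducible character not vanishing at some element outside an index two subgroup
restricts irreducibly. -/
theorem IsIrrChar.res_irr {H : Type} [Group H] [Fintype H] (R : Subgroup H) [Fintype R]
    (h2 : R.index = 2) {η : H → ℂ} (hη : IsIrrChar H η) (c : H) (hc : c ∉ R)
    (hηc : η c ≠ 0) : IsIrrChar R (fun x => η x) := by
  apply hη.res
  have hcard : (Nat.card H : ℂ) = Nat.card R * 2 := by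
    rw [← R.card_mul_index, h2]; push_cast; ring
  have hs := sum_add_sign R h2 (fun g => η g * η g⁻¹)
  rcases (hη.twist (idxTwoSign R h2)).orth hη with h | h
  · exfalso
    have h3 := congrFun h c
    simp only [idxTwoSign_not_mem R h2 hc] at h3
    apply hηc
    linear_combination (-1/2) * h3
  · simp only [mul_assoc] at h
    rw [h, hη.norm, hcard] at hs
    have : (2 : ℂ) ≠ 0 := two_ne_zero
    simp only [Subgroup.coe_inv]
    linear_combination (-1/2) * hs

/-- Two irreducible extensions of an irreducible character differ by a sign. -/
theorem ext_unique {H : Type} [Group H] [Fintype H] (R : Subgroup H) [Fintype R]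
    (h2 : R.index = 2) {χ ψ : H → ℂ} (hχ : IsIrrChar H χ) (hψ : IsIrrChar H ψ)
    (hr : IsIrrChar R (fun x => χ x)) (he : ∀ x : R, χ x = ψ x) :
    χ = ψ ∨ (fun g => idxTwoSign R h2 g * χ g) = ψ := by
  by_contra! hcon
  have h1 := (hχ.orth hψ).resolve_left hcon.1
  have h3 := ((hχ.twist (idxTwoSign R h2)).orth hψ).resolve_left hcon.2
  have hs := sum_add_sign R h2 (fun g => χ g * ψ g⁻¹)
  simp only [mul_assoc] at h3
  have hn := hr.norm
  have e : ∑ x : R, χ x * ψ (x : H)⁻¹ = Nat.card R := by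
    rw [← hn]
    refine Finset.sum_congr rfl fun x _ => ?_
    rw [he x⁻¹]
    rfl
  rw [h1, h3, e] at hs
  have : (Nat.card R : ℂ) ≠ 0 := NeZero.ne _
  apply this
  linear_combination (-1/2) * hs

/-- The defining property of the canonical extension. -/
def GoodExt {H : Type} [Group H] (R : Subgroup H) (c : H) (θ : R → ℂ) (χ : H → ℂ) : Prop :=
  IsIrrChar H χ ∧ (∀ x : R, χ x = θ x) ∧ ∃ n : ℕ, n ≠ 0 ∧ χ c = n

theorem GoodExt.unique {H : Type} [Group H] [Fintype H] (R : Subgroup H)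
    (h2 : R.index = 2) (c : H) (hc : c ∉ R) {θ : R → ℂ} (hθ : IsIrrChar R θ) {χ ψ : H → ℂ}
    (h1 : GoodExt R c θ χ) (h3 : GoodExt R c θ ψ) : χ = ψ := by
  have : Fintype R := Fintype.ofFinite R
  obtain ⟨a1, a2, n, hn, a3⟩ := h1
  obtain ⟨b1, b2, m, hm, b3⟩ := h3
  have e : (fun x : R => χ x) = θ := funext a2
  rcases ext_unique R h2 a1 b1 (e ▸ hθ) (fun x => by rw [a2, b2]) with h | h
  · exact h
  · exfalso
    have h3 := congrFun h c
    simp only [idxTwoSign_not_mem R h2 hc, a3, b3] at h3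
    have h4 : ((n + m : ℕ) : ℂ) = 0 := by push_cast; linear_combination -h3
    have := Nat.cast_eq_zero.1 h4
    omega

theorem GoodExt.exists {H : Type} [Group H] [Fintype H] (R : Subgroup H)
    (h2 : R.index = 2) (c : H) (hc : c ∉ R) (hcc : c * c = 1) {θ : R → ℂ}
    (hθ : MemIrrOddH R θ) : (∃ d : ℕ, Odd d ∧ θ 1 = d) ∧ ∃ χ, GoodExt R c θ χ := by
  have : Fintype R := Fintype.ofFinite R
  obtain ⟨hi, η, hη, ⟨d, hd, hd1⟩, hne⟩ := hθ
  obtain ⟨b, hb⟩ := hη.involution c hcc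
  obtain ⟨z, hz, hz0⟩ : ∃ z : ℤ, η c = z ∧ z ≠ 0 := by
    refine ⟨2 * b - d, by rw [hb, hd1]; push_cast; ring, ?_⟩
    obtain ⟨k, rfl⟩ := hd
    push_cast
    omega
  have hr := hη.res_irr R h2 c hc (by rw [hz]; exact_mod_cast hz0)
  have heq : (fun x : R => η x) = θ := by
    refine (hr.orth hi).resolve_right fun h0 => hne ?_
    rw [finsum_eq_sum_of_fintype]
    simp only [hi.inv] at h0
    rw [h0, mul_zero]
  refine ⟨⟨d, hd, by rw [← heq, ← hd1]; rfl⟩, ?_⟩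
  rcases lt_or_gt_of_ne hz0 with hlt | hgt
  · refine ⟨fun g => idxTwoSign R h2 g * η g, hη.twist _, ?_, z.natAbs, by omega, ?_⟩
    · intro x
      beta_reduce
      rw [idxTwoSign_mem R h2 x.2, one_mul]
      exact congrFun heq x
    · have h5 : ((z.natAbs : ℤ) : ℂ) = ((-z : ℤ) : ℂ) := by congr 1; omega
      beta_reduce
      rw [idxTwoSign_not_mem R h2 hc, hz, neg_one_mul, ← Int.cast_neg, ← h5]
      rfl
  · refine ⟨η, hη, congrFun heq, z.natAbs, by omega, ?_⟩
    have h5 : ((z.natAbs : ℤ) : ℂ) = z := by congr 1; omega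
    rw [hz, ← h5]
    rfl

/-- Let `H = R ⋊ C` be a finite group with `C` of order `2`.  Then there is a
map `Ξ : Irr_{2',H}(R) → Irr(H)` such that `Ξ θ` is an extension of `θ` to `H` (hence of odd
degree), and `Ξ` commutes with every field automorphism of `ℂ`. -/
theorem stmt_3 {H : Type} [Group H] [Finite H] (R C : Subgroup H) (hR : R.Normal)
    (hinf : R ⊓ C = ⊥) (hsup : R ⊔ C = ⊤) (hC : Nat.card ↥C = 2) :
    ∃ Ξ : (↥R → ℂ) → (H → ℂ),
      ∀ θ : ↥R → ℂ, MemIrrOddH R θ →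
        IsIrrChar H (Ξ θ) ∧
        (∀ x : ↥R, Ξ θ ↑x = θ x) ∧
        (∃ d : ℕ, Odd d ∧ Ξ θ 1 = d) ∧
        (∀ σ : ℂ ≃+* ℂ, Ξ (fun x => σ (θ x)) = fun g => σ (Ξ θ g)) := by
  classical
  have : Fintype H := Fintype.ofFinite H
  have hcompl : R.IsComplement' C := by
    apply Subgroup.isComplement'_of_disjoint_and_mul_eq_univ (disjoint_iff.2 hinf)
    rw [← Subgroup.normal_mul, hsup]
    rfl
  have h2 : R.index = 2 := by rw [hcompl.symm.index_eq_card, hC]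
  obtain ⟨c, hcC, hc1⟩ : ∃ c ∈ C, c ≠ 1 := by
    have hb : C ≠ ⊥ := by
      rintro rfl
      simp at hC
    obtain ⟨⟨c, hc⟩, h⟩ := Subgroup.ne_bot_iff_exists_ne_one.1 hb
    exact ⟨c, hc, fun h0 => h (Subtype.ext h0)⟩
  have hc : c ∉ R := fun h => hc1 (by
    have : c ∈ R ⊓ C := ⟨h, hcC⟩
    rwa [hinf, Subgroup.mem_bot] at this)
  have hcc : c * c = 1 := by
    have h := pow_card_eq_one' (x := (⟨c, hcC⟩ : C))
    rw [hC, pow_two] at h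
    exact congrArg Subtype.val h
  refine ⟨fun θ => if h : ∃ χ, GoodExt R c θ χ then h.choose else 0, fun θ hθ => ?_⟩
  obtain ⟨⟨d, hd, hd1⟩, hex⟩ := GoodExt.exists R h2 c hc hcc hθ
  have hg := hex.choose_spec
  simp only [dif_pos hex]
  refine ⟨hg.1, hg.2.1, ⟨d, hd, ?_⟩, fun σ => ?_⟩
  · rw [← hd1, ← hg.2.1 1]
    rfl
  · have hgσ : GoodExt R c (fun x => σ (θ x)) (fun g => σ (hex.choose g)) := by
      obtain ⟨a1, a2, n, hn, a3⟩ := hg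
      refine ⟨a1.galois σ, fun x => congrArg σ (a2 x), n, hn, ?_⟩
      exact (congrArg σ a3).trans (map_natCast σ n)
    have hexσ : ∃ χ, GoodExt R c (fun x => σ (θ x)) χ := ⟨_, hgσ⟩
    rw [dif_pos hexσ]
    have : Fintype R := Fintype.ofFinite R
    exact GoodExt.unique R h2 c hc (hθ.1.galois σ) hexσ.choose_spec hgσ
end

section
/- Let H be a finite group and R a normal subgroup of H such that the quotient H/R is a 2-group (i.e., the index [H : R] is a power of 2). Then every irreducible complex character η of H of odd degree restricts to an irreducible character of R, which then also has odd degree. -/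
open CategoryTheory in
theorem simple_invariant {G : Type} [Group G] (V : FDRep ℂ G) (hV : Simple V)
    (W : Submodule ℂ V) (hW : ∀ g : G, ∀ v ∈ W, V.ρ g v ∈ W) : W = ⊥ ∨ W = ⊤ := by
  let S : Subrepresentation V.ρ := ⟨W, fun g v hv => hW g v hv⟩
  let f : FDRep.of S.toRepresentation ⟶ V :=
    ⟨InducedCategory.homMk (ModuleCat.ofHom W.subtype), fun g => by
      ext1; rfl⟩
  have hmono : Mono f := by
    constructor
    intro Z a b hab
    have key : ∀ z : Z.V, f.hom.hom.hom (a.hom.hom.hom z) = f.hom.hom.hom (b.hom.hom.hom z) := by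
      intro z
      have := congrArg (fun h => h.hom.hom.hom z) hab
      exact this
    apply Action.Hom.ext
    ext z
    exact key z
  by_cases h0 : f = 0
  · left
    rw [eq_bot_iff]
    intro v hv
    have := congrArg (fun h => h.hom.hom.hom (⟨v, hv⟩ : W)) h0
    exact this
  · right
    have hiso : IsIso f := (Simple.mono_isIso_iff_nonzero f).2 h0
    rw [eq_top_iff]
    intro v _
    have h1 : inv f ≫ f = 𝟙 V := IsIso.inv_hom_id f
    have := congrArg (fun h => h.hom.hom.hom v) h1
    have h2 : (((inv f).hom.hom.hom v : W) : V) = v := this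
    rw [← h2]
    exact Subtype.property _

open CategoryTheory in
theorem irreducible_simple {G : Type} [Group G] [Finite G] {V : Type} [AddCommGroup V] [Module ℂ V]
    [FiniteDimensional ℂ V] (ρ : Representation ℂ G V) (h : ρ.IsIrreducible) :
    Simple (FDRep.of ρ) := by
  have := Fintype.ofFinite G
  rw [FDRep.simple_iff_end_is_rank_one]
  have e : (FDRep.of ρ ⟶ FDRep.of ρ) ≃ₗ[ℂ] Representation.IntertwiningMap ρ ρ :=
    { toFun := fun f => ⟨f.hom.hom.hom, fun g => by
        have := congrArg (fun h => h.hom.hom) (f.comm g)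
        exact this⟩
      invFun := fun f => ⟨InducedCategory.homMk (ModuleCat.ofHom f.toLinearMap), fun g => by
        ext1
        exact f.2 g⟩
      map_add' := fun _ _ => rfl
      map_smul' := fun _ _ => rfl
      left_inv := fun _ => rfl
      right_inv := fun _ => rfl }
  rw [e.finrank_eq]
  exact Representation.IsIrreducible.finrank_intertwiningMap_self ρ

theorem index_two_step {G V : Type} [Group G] [AddCommGroup V] [Module ℂ V]
    [FiniteDimensional ℂ V] (ρ : Representation ℂ G V) (hodd : Odd (Module.finrank ℂ V))
    (h : ∀ W : Submodule ℂ V, (∀ g : G, ∀ v ∈ W, ρ g v ∈ W) → W = ⊥ ∨ W = ⊤)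
    (M : Subgroup G) (hM : M.index = 2) (W : Submodule ℂ V)
    (hW : ∀ g ∈ M, ∀ v ∈ W, ρ g v ∈ W) : W = ⊥ ∨ W = ⊤ := by
  obtain ⟨a, ha, -⟩ := Subgroup.index_eq_two_iff_exists_notMem_and.1 hM
  have hinj : Function.Injective (ρ a) := by
    intro x y hxy
    have := congrArg (ρ a⁻¹) hxy
    simpa using this
  let U := W.map (ρ a)
  have hU : ∀ g ∈ M, ∀ v ∈ U, ρ g v ∈ U := by
    rintro g hg _ ⟨w, hw, rfl⟩
    refine ⟨ρ (a⁻¹ * g * a) w, hW _ ?_ w hw, ?_⟩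
    · simp [Subgroup.mul_mem_iff_of_index_two hM, ha, hg]
    · simp only [← Module.End.mul_apply, ← map_mul]
      congr 2
      group
  have hWU : ∀ g ∉ M, ∀ v ∈ W, ρ g v ∈ U := by
    intro g hg w hw
    refine ⟨ρ (a⁻¹ * g) w, hW _ ?_ w hw, ?_⟩
    · simp [Subgroup.mul_mem_iff_of_index_two hM, ha, hg]
    · simp only [← Module.End.mul_apply, ← map_mul]
      congr 2
      group
  have hUW : ∀ g ∉ M, ∀ v ∈ U, ρ g v ∈ W := by
    rintro g hg _ ⟨w, hw, rfl⟩
    rw [← Module.End.mul_apply, ← map_mul]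
    exact hW _ (by simp [Subgroup.mul_mem_iff_of_index_two hM, ha, hg]) w hw
  have hinf := h (W ⊓ U) (by
    rintro g v ⟨h1, h2⟩
    by_cases hg : g ∈ M
    · exact ⟨hW g hg v h1, hU g hg v h2⟩
    · exact ⟨hUW g hg v h2, hWU g hg v h1⟩)
  have hsup := h (W ⊔ U) (by
    intro g v hv
    obtain ⟨x, hx, y, hy, rfl⟩ := Submodule.mem_sup.1 hv
    rw [map_add]
    by_cases hg : g ∈ M
    · exact Submodule.add_mem_sup (hW g hg x hx) (hU g hg y hy)
    · rw [add_comm]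
      exact Submodule.add_mem_sup (hUW g hg y hy) (hWU g hg x hx))
  rcases hsup with hsup | hsup
  · left
    exact eq_bot_iff.2 (hsup ▸ le_sup_left)
  rcases hinf with hinf | hinf
  · exfalso
    have h1 := Submodule.finrank_sup_add_finrank_inf_eq W U
    have h2 : Module.finrank ℂ U = Module.finrank ℂ W :=
      (Submodule.equivMapOfInjective (ρ a) hinj W).finrank_eq.symm
    rw [hsup, hinf, h2, finrank_top, finrank_bot] at h1
    rw [show Module.finrank ℂ V = Module.finrank ℂ W + Module.finrank ℂ W by omega] at hodd
    exact (Nat.not_odd_iff_even.2 (Even.add_self _)) hodd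
  · right
    exact eq_top_iff.2 (hinf ▸ inf_le_left)

theorem two_power_step {V : Type} [AddCommGroup V] [Module ℂ V]
    [FiniteDimensional ℂ V] (hodd : Odd (Module.finrank ℂ V)) (k : ℕ) :
    ∀ {G : Type} [Group G] [Finite G] (ρ : Representation ℂ G V)
    (_ : ∀ W : Submodule ℂ V, (∀ g : G, ∀ v ∈ W, ρ g v ∈ W) → W = ⊥ ∨ W = ⊤)
    (R : Subgroup G) (_ : R.Normal) (_ : R.index = 2 ^ k) (W : Submodule ℂ V)
    (_ : ∀ g ∈ R, ∀ v ∈ W, ρ g v ∈ W), W = ⊥ ∨ W = ⊤ := by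
  induction k with
  | zero =>
    intro G _ _ ρ h R hR hk W hW
    have : R = ⊤ := by simpa using hk
    subst this
    exact h W (fun g => hW g trivial)
  | succ k ih =>
    intro G _ _ ρ h R hR hk W hW
    have : Fact (Nat.Prime 2) := ⟨Nat.prime_two⟩
    have hcard : Nat.card (G ⧸ R) = 2 ^ (k + 1) := hk
    obtain ⟨K, hK⟩ := Sylow.exists_subgroup_card_pow_prime (G := G ⧸ R) 2 (n := k)
      (by rw [hcard]; exact pow_dvd_pow _ (Nat.le_succ k))
    have hKi : K.index = 2 := by
      have := K.card_mul_index
      rw [hK, hcard, pow_succ] at this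
      exact Nat.eq_of_mul_eq_mul_left (by positivity) this
    let M := K.comap (QuotientGroup.mk' R)
    have hM : M.index = 2 := by
      rw [← hKi]
      exact K.index_comap_of_surjective (QuotientGroup.mk'_surjective R)
    have hRM : R ≤ M := QuotientGroup.le_comap_mk' R K
    have hrel : (R.subgroupOf M).index = 2 ^ k := by
      have := Subgroup.relIndex_mul_index hRM
      rw [hM, hk, pow_succ] at this
      exact Nat.eq_of_mul_eq_mul_right (by positivity) this
    refine ih (ρ.comp M.subtype) ?_ (R.subgroupOf M) inferInstance hrel W ?_
    · intro W' hW'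
      exact index_two_step ρ hodd h M hM W' (fun g hg v hv => hW' ⟨g, hg⟩ v hv)
    · intro g hg v hv
      exact hW g hg v hv

/-- If `R ⊴ H` with `H/R` a `2`-group, then every odd-degree irreducible
character of `H` restricts irreducibly to `R`, and the restriction has odd degree. -/
theorem stmt_4 {H : Type} [Group H] [Finite H] (R : Subgroup H) (hR : R.Normal)
    (hidx : ∃ k : ℕ, R.index = 2 ^ k)
    (η : H → ℂ) (hη : IsIrrChar H η) (hηodd : ∃ d : ℕ, Odd d ∧ η 1 = d) :
    IsIrrChar ↥R (fun x : ↥R => η ↑x) ∧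
      ∃ d : ℕ, Odd d ∧ (fun x : ↥R => η ↑x) 1 = d := by
  obtain ⟨V, hV, rfl⟩ := hη
  obtain ⟨k, hk⟩ := hidx
  obtain ⟨d, hd, hd1⟩ := hηodd
  refine ⟨?_, d, hd, by simpa using hd1⟩
  have hfin : Module.finrank ℂ V = d := by
    rw [FDRep.char_one] at hd1
    exact_mod_cast hd1
  have hodd : Odd (Module.finrank ℂ V) := hfin ▸ hd
  have key := two_power_step hodd k V.ρ (simple_invariant V hV) R hR hk
  let σ : Representation ℂ R V := V.ρ.comp R.subtype
  refine ⟨FDRep.of σ, irreducible_simple σ ?_, rfl⟩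
  have hnt : Nontrivial V := Module.nontrivial_of_finrank_pos (R := ℂ) hodd.pos
  refine { exists_pair_ne := ⟨⊥, ⊤, ?_⟩, eq_bot_or_eq_top := ?_ }
  · intro h
    exact bot_ne_top (α := Submodule ℂ V) (congrArg Subrepresentation.toSubmodule h)
  · intro S
    rcases key S.toSubmodule (fun g hg v hv => S.apply_mem_toSubmodule ⟨g, hg⟩ hv) with h | h
    · exact Or.inl (Subrepresentation.toSubmodule_injective h)
    · exact Or.inr (Subrepresentation.toSubmodule_injective h)
end

section
/- Let H be a finite group with H = R ⋊ C, i.e., R is a normal subgroup of H and C is a subgroup with R ∩ C = 1 and RC = H, where every element of C squares to the identity (so C is an elementary abelian 2-group). Suppose every irreducible complex character of R is rational-valued. Then every irreducible complex character of H of odd degree is rational-valued; equivalently, every odd-degree irreducible character of H is fixed by every field automorphism of ℂ. -/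
open Module

lemma irr_step {H V : Type} [Group H] [AddCommGroup V] [Module ℂ V] [FiniteDimensional ℂ V]
    (ρ : H →* (V →ₗ[ℂ] V)) (hodd : Odd (finrank ℂ V)) (K : Subgroup H)
    (hsq : ∀ x : H, x * x ∈ K) (g : H)
    (hK' : ∀ U : Submodule ℂ V, (∀ k ∈ K, ∀ u ∈ U, ρ k u ∈ U) → (∀ u ∈ U, ρ g u ∈ U) →
      U = ⊥ ∨ U = ⊤) (U : Submodule ℂ V) (hU : ∀ k ∈ K, ∀ u ∈ U, ρ k u ∈ U) :
    U = ⊥ ∨ U = ⊤ := by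
  have hconj : ∀ k ∈ K, g⁻¹ * k * g ∈ K := by
    intro k hk
    have h1 := hsq (g⁻¹ * k)
    have h2 := K.mul_mem (K.mul_mem h1 (K.inv_mem hk)) (hsq g)
    convert h2 using 1
    group
  have hmul : ∀ a b v, ρ a (ρ b v) = ρ (a * b) v := by intro a b v; simp
  set W := U.map (ρ g) with hW
  have hWK : ∀ k ∈ K, ∀ u ∈ W, ρ k u ∈ W := by
    rintro k hk _ ⟨u, hu, rfl⟩
    refine ⟨ρ (g⁻¹ * k * g) u, hU _ (hconj k hk) u hu, ?_⟩
    rw [hmul, hmul]; congr 2; group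
  have hUg : ∀ u ∈ U, ρ g u ∈ W := fun u hu => ⟨u, hu, rfl⟩
  have hWg : ∀ u ∈ W, ρ g u ∈ U := by
    rintro _ ⟨u, hu, rfl⟩
    rw [hmul]; exact hU _ (hsq g) u hu
  have hfr : finrank ℂ W = finrank ℂ U := by
    have hinj : Function.Injective (ρ g) := by
      intro a b hab
      have := congrArg (ρ g⁻¹) hab
      rw [hmul, hmul] at this
      simpa using this
    exact (Submodule.equivMapOfInjective (ρ g) hinj U).finrank_eq.symm
  have h1 := hK' (U ⊓ W) (fun k hk u hu => ⟨hU k hk u hu.1, hWK k hk u hu.2⟩)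
    (fun u hu => ⟨hWg u hu.2, hUg u hu.1⟩)
  have h2 := hK' (U ⊔ W) (fun k hk u hu => by
      obtain ⟨a, ha, b, hb, rfl⟩ := Submodule.mem_sup.1 hu
      rw [map_add]
      exact Submodule.add_mem_sup (hU k hk a ha) (hWK k hk b hb))
    (fun u hu => by
      obtain ⟨a, ha, b, hb, rfl⟩ := Submodule.mem_sup.1 hu
      rw [map_add, add_comm]
      exact Submodule.add_mem_sup (hWg b hb) (hUg a ha))
  rcases h1 with h1 | h1
  · rcases h2 with h2 | h2
    · left; exact le_bot_iff.1 (h2 ▸ le_sup_left)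
    · exfalso
      have := Submodule.finrank_sup_add_finrank_inf_eq U W
      rw [h1, h2, hfr, finrank_bot, finrank_top] at this
      rw [add_zero] at this
      rw [this] at hodd
      exact (Nat.not_even_iff_odd.2 hodd) ⟨_, rfl⟩
  · right; exact top_le_iff.1 (h1 ▸ inf_le_left)

lemma irr_all {H V : Type} [Group H] [Finite H] [AddCommGroup V] [Module ℂ V]
    [FiniteDimensional ℂ V]
    (ρ : H →* (V →ₗ[ℂ] V)) (hodd : Odd (finrank ℂ V))
    (hH : ∀ U : Submodule ℂ V, (∀ k, ∀ u ∈ U, ρ k u ∈ U) → U = ⊥ ∨ U = ⊤)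
    (K : Subgroup H) : (∀ x : H, x * x ∈ K) → 
    ∀ (U : Submodule ℂ V), (∀ k ∈ K, ∀ u ∈ U, ρ k u ∈ U) → U = ⊥ ∨ U = ⊤ := by
  induction K using WellFoundedGT.induction with
  | ind K ih =>
  intro hsq
  by_cases hK : K = ⊤
  · subst hK
    intro U hU
    exact hH U (fun k => hU k trivial)
  obtain ⟨g, hg⟩ : ∃ g, g ∉ K := by
    by_contra! h
    exact hK ((Subgroup.eq_top_iff' K).2 h)
  refine irr_step ρ hodd K hsq g ?_
  intro U hU hUg
  have hlt : K < K ⊔ Subgroup.zpowers g := by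
    refine lt_of_le_of_ne le_sup_left ?_
    intro h
    apply hg
    rw [h]
    exact (le_sup_right : Subgroup.zpowers g ≤ _) (Subgroup.mem_zpowers g)
  refine ih _ hlt (fun x => hlt.le (hsq x)) U ?_
  let S : Submonoid H :=
    { carrier := {h | ∀ u ∈ U, ρ h u ∈ U}
      one_mem' := by intro u hu; simpa using hu
      mul_mem' := by
        intro a b ha hb u hu
        have := ha _ (hb u hu)
        simpa using this }
  let S' : Subgroup H := { S with
      inv_mem' := by
        intro x hx
        have : x⁻¹ = x ^ (orderOf x - 1) := by
          rw [eq_comm, ← mul_eq_one_iff_eq_inv, ← pow_succ, Nat.sub_add_cancel (orderOf_pos x),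
            pow_orderOf_eq_one]
        change x⁻¹ ∈ S
        rw [this]
        exact S.pow_mem hx _ }
  have : K ⊔ Subgroup.zpowers g ≤ S' := by
    rw [sup_le_iff, Subgroup.zpowers_le]
    exact ⟨fun k hk => hU k hk, hUg⟩
  exact fun k hk => this hk

lemma trace_nondeg {V : Type} [AddCommGroup V] [Module ℂ V] [FiniteDimensional ℂ V]
    (A : V →ₗ[ℂ] V) (h : ∀ B : V →ₗ[ℂ] V, LinearMap.trace ℂ V (A * B) = 0) : A = 0 := by
  ext v
  rw [LinearMap.zero_apply, ← forall_dual_apply_eq_zero_iff ℂ]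
  intro f
  have := h (f.smulRight v)
  have e : A * (f.smulRight v) = f.smulRight (A v) := by ext; simp
  rw [e] at this
  simpa using this

lemma schur {G V : Type} [Group G] [AddCommGroup V] [Module ℂ V] [FiniteDimensional ℂ V]
    [Nontrivial V] (ρ : G →* (V →ₗ[ℂ] V))
    (hirr : ∀ U : Submodule ℂ V, (∀ k, ∀ u ∈ U, ρ k u ∈ U) → U = ⊥ ∨ U = ⊤)
    (T : V →ₗ[ℂ] V) (hT : ∀ g v, T (ρ g v) = ρ g (T v)) : ∃ c : ℂ, T = c • 1 := by
  obtain ⟨c, hc⟩ := Module.End.exists_eigenvalue T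
  refine ⟨c, ?_⟩
  have := (hirr (Module.End.eigenspace T c) (fun k u hu => by
    rw [Module.End.mem_eigenspace_iff] at hu ⊢
    rw [hT, hu, map_smul])).resolve_left hc
  ext v
  have hv : v ∈ Module.End.eigenspace T c := this ▸ trivial
  simpa [Module.End.mem_eigenspace_iff] using hv

lemma burnside {G V : Type} [Group G] [AddCommGroup V] [Module ℂ V] [FiniteDimensional ℂ V]
    [Nontrivial V] (ρ : G →* (V →ₗ[ℂ] V))
    (hirr : ∀ U : Submodule ℂ V, (∀ k, ∀ u ∈ U, ρ k u ∈ U) → U = ⊥ ∨ U = ⊤)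
    : Submodule.span ℂ (Set.range ρ) = ⊤ := by
  let A : Subalgebra ℂ (Module.End ℂ V) := Algebra.adjoin ℂ (Set.range ρ)
  have hspan : Subalgebra.toSubmodule A = Submodule.span ℂ (Set.range ρ) := by
    have := Algebra.adjoin_eq_span ℂ (Set.range ρ)
    rw [this]
    congr 1
    have h := Submonoid.closure_eq (MonoidHom.mrange ρ)
    rw [MonoidHom.coe_mrange] at h
    rw [h, MonoidHom.coe_mrange]
  have hmem : ∀ g, ρ g ∈ A := fun g => Algebra.subset_adjoin ⟨g, rfl⟩
  have : IsSimpleModule A V := by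
    rw [isSimpleModule_iff]
    refine { exists_pair_ne := ⟨⊥, ⊤, bot_ne_top⟩, eq_bot_or_eq_top := fun U => ?_ }
    rcases hirr (U.restrictScalars ℂ) (fun k u hu => U.smul_mem (⟨ρ k, hmem k⟩ : A) hu) with h | h
    · left; simpa using h
    · right; simpa using h
  have hdense := jacobson_density (R := A) (M := V)
  rw [← hspan, eq_top_iff]
  rintro f -
  have hs : ∀ φ : Module.End A V, ∃ c : ℂ, ∀ v, φ v = c • v := by
    intro φ
    obtain ⟨c, hc⟩ := schur ρ hirr (φ.restrictScalars ℂ)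
      (fun g v => φ.map_smul (⟨ρ g, hmem g⟩ : A) v)
    exact ⟨c, fun v => congrArg (fun T : V →ₗ[ℂ] V => T v) hc⟩
  let F : Module.End (Module.End A V) V :=
    { toFun := f
      map_add' := map_add f
      map_smul' := fun φ v => by
        obtain ⟨c, hc⟩ := hs φ
        simp [hc] }
  classical
  let b := Module.finBasis ℂ V
  obtain ⟨r, hr⟩ := hdense F (Finset.univ.image b)
  have : f = r.1 := by
    apply b.ext
    intro i
    exact hr (b i) (by simp)
  rw [this]
  exact r.2

lemma key {G V : Type} [Group G] [Finite G] [AddCommGroup V] [Module ℂ V] [FiniteDimensional ℂ V]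
    [Nontrivial V] (ρ : G →* (V →ₗ[ℂ] V))
    (hirr : ∀ U : Submodule ℂ V, (∀ k, ∀ u ∈ U, ρ k u ∈ U) → U = ⊥ ∨ U = ⊤)
    (q : G → ℚ) (hq : ∀ g, LinearMap.trace ℂ V (ρ g) = q g)
    (T : V →ₗ[ℂ] V) (hT2 : T * T = 1) (φ : G → G) (hT : ∀ g, T * ρ g = ρ (φ g) * T)
    (t : ℚ) (ht : LinearMap.trace ℂ V T = t) (ht0 : t ≠ 0) (y : G) :
    ∃ s : ℚ, LinearMap.trace ℂ V (ρ y * T) = s := by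
  have := Fintype.ofFinite G
  have hb := burnside ρ hirr
  obtain ⟨a, ha⟩ : ∃ a : G → ℂ, ∑ r, a r • ρ r = T := by
    rw [← Submodule.mem_span_range_iff_exists_fun ℂ, hb]; trivial
  obtain ⟨π, hπ⟩ := LinearMap.exists_leftInverse_of_injective (Algebra.linearMap ℚ ℂ)
    (LinearMap.ker_eq_bot.2 (algebraMap ℚ ℂ).injective)
  have hπ1 : ∀ x : ℚ, π (x : ℂ) = x := fun x => congrArg (fun f : ℚ →ₗ[ℚ] ℚ => f x) hπ
  have hπm : ∀ (z : ℂ) (x : ℚ), π (z * x) = π z * x := by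
    intro z x
    have : z * x = x • z := by rw [mul_comm, Rat.smul_def]
    rw [this, map_smul, smul_eq_mul, mul_comm]
  -- trace formula
  have htr : ∀ (b : G → ℂ) (u v : G),
      LinearMap.trace ℂ V (ρ u * (∑ r, b r • ρ r) * ρ v) = ∑ r, b r * q (u * r * v) := by
    intro b u v
    rw [Finset.mul_sum, Finset.sum_mul, map_sum]
    refine Finset.sum_congr rfl fun r _ => ?_
    rw [← hq]
    simp
  set T' : V →ₗ[ℂ] V := ∑ r, ((π (a r) : ℚ) : ℂ) • ρ r with hT'
  have htr' : ∀ (u v : G) (s : ℚ), LinearMap.trace ℂ V (ρ u * T * ρ v) = s →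
      LinearMap.trace ℂ V (ρ u * T' * ρ v) = s := by
    intro u v s h
    rw [← ha, htr] at h
    rw [hT', htr]
    have h2 := congrArg π h
    rw [map_sum, hπ1] at h2
    simp only [hπm] at h2
    rw [← h2]
    push_cast
    rfl
  have hcomm : ∀ g, T' * ρ g = ρ (φ g) * T' := by
    intro g
    rw [← sub_eq_zero]
    apply trace_nondeg
    intro B
    have hB : B ∈ Submodule.span ℂ (Set.range ρ) := hb ▸ trivial
    induction hB using Submodule.span_induction with
    | zero => simp
    | add x y _ _ hx hy => rw [mul_add, map_add, hx, hy, add_zero]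
    | smul c x _ hx => rw [mul_smul_comm, map_smul, hx, smul_zero]
    | mem x hx =>
      obtain ⟨y, rfl⟩ := hx
      have h1 : ∑ r, a r * ((q (1 * r * (g * y)) - q (φ g * r * y) : ℚ) : ℂ) = 0 := by
        push_cast
        simp only [mul_sub, Finset.sum_sub_distrib]
        rw [← htr, ← htr, ha, map_one, one_mul, map_mul ρ, ← mul_assoc, hT, sub_self]
      have h2 := congrArg π h1
      rw [map_sum, map_zero] at h2
      simp only [hπm] at h2
      have h3 : ∑ r, ((π (a r) : ℚ) : ℂ) * ((q (1 * r * (g * y)) - q (φ g * r * y) : ℚ) : ℂ) = 0 := by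
        exact_mod_cast h2
      push_cast at h3
      simp only [mul_sub, Finset.sum_sub_distrib] at h3
      rw [← htr, ← htr, map_one, one_mul, map_mul ρ, ← mul_assoc, ← map_sub, ← sub_mul] at h3
      exact h3
  obtain ⟨c, hc⟩ := schur ρ hirr (T * T') (by
    intro g v
    have : T * T' * ρ g = ρ g * (T * T') := by
      have h1 : T * ρ (φ g) = ρ g * T := by
        calc T * ρ (φ g) = T * (ρ (φ g) * T) * T := by rw [mul_assoc, mul_assoc, hT2, mul_one]
          _ = T * (T * ρ g) * T := by rw [hT]
          _ = ρ g * T := by rw [← mul_assoc, hT2, one_mul]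
      rw [mul_assoc, hcomm, ← mul_assoc, h1, mul_assoc]
    exact congrArg (fun f : V →ₗ[ℂ] V => f v) this)
  have hc' : T' = c • T := by
    calc T' = T * (T * T') := by rw [← mul_assoc, hT2, one_mul]
      _ = c • T := by rw [hc, mul_smul_comm, mul_one]
  have htT' : LinearMap.trace ℂ V T' = t := by
    have := htr' 1 1 t (by simpa using ht)
    simpa using this
  have hc1 : c = 1 := by
    rw [hc', map_smul, ht, smul_eq_mul] at htT'
    have : (t : ℂ) ≠ 0 := by exact_mod_cast ht0
    exact mul_right_cancel₀ this (by rw [htT', one_mul])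
  rw [hc1, one_smul] at hc'
  have := htr (fun r => ((π (a r) : ℚ) : ℂ)) y 1
  rw [← hT', hc', map_one, mul_one] at this
  exact ⟨∑ r, π (a r) * q (y * r * 1), by rw [this]; push_cast; rfl⟩

lemma trace_invol {V : Type} [AddCommGroup V] [Module ℂ V] [FiniteDimensional ℂ V]
    (hodd : Odd (finrank ℂ V)) (T : V →ₗ[ℂ] V) (hT2 : T * T = 1) :
    ∃ t : ℚ, t ≠ 0 ∧ LinearMap.trace ℂ V T = t := by
  set e : V →ₗ[ℂ] V := (1/2 : ℂ) • (1 + T) with he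
  have hid : IsIdempotentElem e := by
    change e * e = e
    rw [he, smul_mul_smul_comm, add_mul, mul_add, mul_add, hT2, one_mul, one_mul, mul_one,
      add_comm T 1, ← two_smul ℂ (1 + T), smul_smul]
    norm_num
  have h1 := (LinearMap.IsIdempotentElem.isProj_range e hid).trace
  have hTe : T = (2:ℂ) • e - 1 := by
    rw [he, smul_smul]; norm_num
  refine ⟨2 * (finrank ℂ (LinearMap.range e) : ℚ) - finrank ℂ V, ?_, ?_⟩
  · intro h
    have : 2 * finrank ℂ (LinearMap.range e) = finrank ℂ V := by
      have := sub_eq_zero.1 h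
      exact_mod_cast this
    rw [← this] at hodd
    exact (Nat.not_even_iff_odd.2 hodd) (even_two_mul _)
  · rw [hTe, map_sub, map_smul, h1, LinearMap.trace_one]
    push_cast
    rfl

open CategoryTheory

lemma simple_irr {H : Type} [Group H] (V : FDRep ℂ H) (hV : Simple V)
    (U : Submodule ℂ V) (hU : ∀ k, ∀ u ∈ U, V.ρ k u ∈ U) : U = ⊥ ∨ U = ⊤ := by
  let σ : Representation ℂ H U :=
    { toFun g := (V.ρ g).restrict (hU g)
      map_one' := by ext; simp
      map_mul' x y := by ext; simp }
  let f : FDRep.of σ ⟶ V :=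
    ⟨InducedCategory.homMk (ModuleCat.ofHom U.subtype), fun g => by
      ext1
      rfl⟩
  have hinj : Function.Injective f.hom.hom.hom := U.injective_subtype
  have hm : Mono f := by
    constructor
    intro Z a b hab
    apply Action.Hom.ext
    apply InducedCategory.hom_ext
    apply ModuleCat.hom_ext
    apply LinearMap.ext
    intro z
    apply hinj
    exact congrArg (fun F : Z ⟶ V => F.hom.hom.hom z) hab
  by_cases h0 : f = 0
  · left
    rw [Submodule.eq_bot_iff]
    intro u hu
    have := congrArg (fun F : FDRep.of σ ⟶ V => F.hom.hom.hom (⟨u, hu⟩ : U)) h0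
    exact this
  · right
    have hi : IsIso f := isIso_of_mono_of_nonzero h0
    rw [eq_top_iff]
    rintro v -
    have := congrArg (fun F : V ⟶ V => F.hom.hom.hom v) (IsIso.inv_hom_id f)
    have h2 : U.subtype ((inv f).hom.hom.hom v) = v := this
    rw [← h2]
    exact Subtype.mem _

lemma irr_simple {G V : Type} [Group G] [Finite G] [AddCommGroup V] [Module ℂ V]
    [FiniteDimensional ℂ V] [Nontrivial V] (ρ : G →* (V →ₗ[ℂ] V))
    (hirr : ∀ U : Submodule ℂ V, (∀ k, ∀ u ∈ U, ρ k u ∈ U) → U = ⊥ ∨ U = ⊤) :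
    Simple (FDRep.of ρ) := by
  rw [FDRep.simple_iff_end_is_rank_one]
  refine finrank_eq_one (𝟙 _) ?_ ?_
  · intro h
    obtain ⟨v, hv⟩ := exists_ne (0 : V)
    exact hv (congrArg (fun F : FDRep.of ρ ⟶ FDRep.of ρ => F.hom.hom.hom v) h)
  · intro f
    obtain ⟨c, hc⟩ := schur ρ hirr f.hom.hom.hom (fun g v =>
      congrArg (fun F : (FDRep.of ρ).V ⟶ (FDRep.of ρ).V => F.hom.hom v) (f.comm g))
    refine ⟨c, ?_⟩
    apply Action.Hom.ext
    apply InducedCategory.hom_ext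
    apply ModuleCat.hom_ext
    exact hc.symm


/-- Let `H = R ⋊ C` be a finite group with `C` an elementary abelian `2`-group.
If every irreducible character of `R` is rational-valued, then every odd-degree irreducible
character of `H` is rational-valued, equivalently, fixed by every field automorphism of `ℂ`. -/
theorem stmt_5 {H : Type} [Group H] [Finite H] (R C : Subgroup H) (hR : R.Normal)
    (hinf : R ⊓ C = ⊥) (hsup : R ⊔ C = ⊤) (hC2 : ∀ c ∈ C, c * c = 1)
    (hRrat : ∀ θ : ↥R → ℂ, IsIrrChar ↥R θ → ∀ x : ↥R, ∃ s : ℚ, θ x = (s : ℂ))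
    (η : H → ℂ) (hη : IsIrrChar H η) (hηodd : ∃ d : ℕ, Odd d ∧ η 1 = d) :
    (∀ g : H, ∃ s : ℚ, η g = (s : ℂ)) ∧
      ∀ σ : ℂ ≃+* ℂ, (fun g => σ (η g)) = η := by
  obtain ⟨V, hV, rfl⟩ := hη
  obtain ⟨d, hd, hd1⟩ := hηodd
  have hdim : finrank ℂ V = d := by
    have h := FDRep.char_one V
    rw [hd1] at h
    exact_mod_cast h.symm
  have hodd : Odd (finrank ℂ V) := hdim ▸ hd
  have hnt : Nontrivial V := by
    apply Module.nontrivial_of_finrank_pos (R := ℂ)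
    exact hodd.pos
  have hdec : ∀ g : H, ∃ r ∈ R, ∃ c ∈ C, r * c = g := by
    intro g
    have hg : g ∈ R ⊔ C := hsup ▸ trivial
    exact Subgroup.mem_sup_of_normal_left.1 hg
  have hsq : ∀ x : H, x * x ∈ R := by
    intro x
    obtain ⟨r, hr, c, hc, rfl⟩ := hdec x
    have h1 := R.mul_mem hr (hR.conj_mem r hr c)
    have h2 : c⁻¹ = c := inv_eq_of_mul_eq_one_left (hC2 c hc)
    rw [h2] at h1
    convert h1 using 1
    group
  have hirr0 := irr_all V.ρ hodd (simple_irr V hV) R hsq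
  let ρR : R →* (V →ₗ[ℂ] V) := V.ρ.comp R.subtype
  have hirr : ∀ U : Submodule ℂ V, (∀ k, ∀ u ∈ U, ρR k u ∈ U) → U = ⊥ ∨ U = ⊤ :=
    fun U hU => hirr0 U (fun k hk => hU ⟨k, hk⟩)
  have hsimple := irr_simple ρR hirr
  have hrat := hRrat _ ⟨FDRep.of ρR, hsimple, rfl⟩
  choose q hq using hrat
  have main : ∀ g : H, ∃ s : ℚ, V.character g = (s : ℂ) := by
    intro g
    obtain ⟨r, hr, c, hc, rfl⟩ := hdec g
    have hT2 : V.ρ c * V.ρ c = 1 := by rw [← map_mul, hC2 c hc, map_one]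
    obtain ⟨t, ht0, ht⟩ := trace_invol hodd (V.ρ c) hT2
    obtain ⟨s, hs⟩ := key ρR hirr q hq (V.ρ c) hT2
      (fun x => ⟨c * x.1 * c⁻¹, hR.conj_mem x.1 x.2 c⟩) (by
        intro x
        change V.ρ c * V.ρ x.1 = V.ρ (c * x.1 * c⁻¹) * V.ρ c
        rw [← map_mul, ← map_mul]
        congr 1
        group) t ht ht0 ⟨r, hr⟩
    refine ⟨s, ?_⟩
    rw [← hs]
    change LinearMap.trace ℂ V (V.ρ (r * c)) = LinearMap.trace ℂ V (V.ρ r * V.ρ c)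
    rw [map_mul V.ρ]
  refine ⟨main, fun σ => ?_⟩
  funext g
  obtain ⟨s, hs⟩ := main g
  rw [hs, map_ratCast]
end
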